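/- arXiv:1610.07019 — 14 statements merged into one kernel-verified Lean document; each statement's English description precedes it below -/
import Mathlib

section
/- Assume a < b and a < c. Then the two configurations σ_{[1,3]} (value 1 on even levels, 3 on odd levels) and σ_{[3,1]} (value 3 on even levels, 1 on odd levels) are G₂-periodic ground states, and every ground state of the λ-model equals one of these two; in particular there are exactly two ground states. -/
/-- Vertices of the semi-infinite Cayley tree of order 2: finite words over a
two-letter alphabet (the root is the empty word). -/
abbrev Vertex : Type := List (Fin 2)

/-- Spin configurations: the values `0, 1, 2` of `Fin 3` encode the spins `1, 2, 3`. -/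
abbrev Config : Type := Vertex → Fin 3

/-- The interaction `λ`: it equals `a` if `|i - j| = 2`, `b` if `|i - j| = 1`,
and `c` if `i = j`. -/
noncomputable def lam (a b c : ℝ) (i j : Fin 3) : ℝ :=
  if ((i : ℤ) - (j : ℤ)).natAbs = 2 then a
  else if ((i : ℤ) - (j : ℤ)).natAbs = 1 then b
  else c

/-- The ball energy `U_x(σ) = (λ(σ(x),σ(x1)) + λ(σ(x),σ(x2)))/2`. -/
noncomputable def ballEnergy (a b c : ℝ) (σ : Config) (x : Vertex) : ℝ :=
  (lam a b c (σ x) (σ (x ++ [0])) + lam a b c (σ x) (σ (x ++ [1]))) / 2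

/-- `min {(α+β)/2 : α, β ∈ {a,b,c}}`. -/
noncomputable def minEnergy (a b c : ℝ) : ℝ :=
  sInf {u : ℝ | ∃ α ∈ ({a, b, c} : Set ℝ), ∃ β ∈ ({a, b, c} : Set ℝ), u = (α + β) / 2}

/-- A configuration is a ground state if every ball energy attains the minimal value. -/
def IsGroundState (a b c : ℝ) (σ : Config) : Prop :=
  ∀ x : Vertex, ballEnergy a b c σ x = minEnergy a b c

/-- `σ` is `G_m`-periodic if `σ(g ∘ x) = σ(x)` whenever `m` divides the length of `g`. -/
def GPeriodic (m : ℕ) (σ : Config) : Prop :=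
  ∀ g x : Vertex, m ∣ g.length → σ (g ++ x) = σ x

/-- `σ` is translation-invariant if `σ(g ∘ x) = σ(x)` for all words `g`. -/
def TranslationInvariant (σ : Config) : Prop :=
  ∀ g x : Vertex, σ (g ++ x) = σ x

/-- The configuration `σ_{[1,3]}`: spin 1 on even levels, spin 3 on odd levels. -/
def sigma13 : Config := fun x => if x.length % 2 = 0 then 0 else 2

/-- The configuration `σ_{[3,1]}`: spin 3 on even levels, spin 1 on odd levels. -/
def sigma31 : Config := fun x => if x.length % 2 = 0 then 2 else 0

theorem lam_ge {a b c : ℝ} (hab : a < b) (hac : a < c) (i j : Fin 3) : a ≤ lam a b c i j := by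
  unfold lam
  split_ifs <;> linarith

/-- When `a` is the strict minimum, the edges of energy `a` are those joining the spins
`0` and `2`. -/
theorem lam_eq_iff {a b c : ℝ} (hab : a < b) (hac : a < c) (i j : Fin 3) :
    lam a b c i j = a ↔ (i = 0 ∧ j = 2) ∨ (i = 2 ∧ j = 0) := by
  fin_cases i <;> fin_cases j <;> simp [lam, hab.ne', hac.ne']

theorem minEnergy_eq {a b c : ℝ} (hab : a < b) (hac : a < c) : minEnergy a b c = a := by
  refine IsLeast.csInf_eq ⟨⟨a, by simp, a, by simp, by ring⟩, ?_⟩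
  rintro u ⟨α, hα, β, hβ, rfl⟩
  simp only [Set.mem_insert_iff, Set.mem_singleton_iff] at hα hβ
  rcases hα with rfl | rfl | rfl <;> rcases hβ with rfl | rfl | rfl <;> linarith

theorem isGroundState_iff {a b c : ℝ} (hab : a < b) (hac : a < c) (σ : Config) :
    IsGroundState a b c σ ↔ ∀ (x : Vertex) (i : Fin 2),
      (σ x = 0 ∧ σ (x ++ [i]) = 2) ∨ (σ x = 2 ∧ σ (x ++ [i]) = 0) := by
  refine forall_congr' fun x => ?_
  rw [minEnergy_eq hab hac, ballEnergy, Fin.forall_fin_two,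
    ← lam_eq_iff hab hac, ← lam_eq_iff hab hac]
  have h₀ := lam_ge hab hac (σ x) (σ (x ++ [0]))
  have h₁ := lam_ge hab hac (σ x) (σ (x ++ [1]))
  constructor
  · intro h
    constructor <;> linarith
  · rintro ⟨h, h'⟩
    linarith

theorem gPeriodic_of_length_mod {m : ℕ} {α : ℕ → Fin 3} :
    GPeriodic m fun x => α (x.length % m) := by
  rintro g x ⟨k, hk⟩
  simp [hk]

/-- if `a < b` and `a < c`, then `σ_{[1,3]}` and `σ_{[3,1]}` are
`G₂`-periodic ground states and every ground state equals one of them. -/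
theorem stmt1 (a b c : ℝ) (hab : a < b) (hac : a < c) :
    (GPeriodic 2 sigma13 ∧ IsGroundState a b c sigma13) ∧
    (GPeriodic 2 sigma31 ∧ IsGroundState a b c sigma31) ∧
    (∀ σ : Config, IsGroundState a b c σ → σ = sigma13 ∨ σ = sigma31) := by
  refine ⟨⟨gPeriodic_of_length_mod (α := fun n => if n = 0 then 0 else 2), ?_⟩,
    ⟨gPeriodic_of_length_mod (α := fun n => if n = 0 then 2 else 0), ?_⟩, fun σ hσ => ?_⟩
  · rw [isGroundState_iff hab hac]
    intro x i
    rcases Nat.mod_two_eq_zero_or_one x.length with h | h <;>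
      simp [sigma13, Nat.add_mod, h]
  · rw [isGroundState_iff hab hac]
    intro x i
    rcases Nat.mod_two_eq_zero_or_one x.length with h | h <;>
      simp [sigma31, Nat.add_mod, h]
  · rw [isGroundState_iff hab hac] at hσ
    rcases hσ [] 0 with ⟨h, -⟩ | ⟨h, -⟩
    · left
      funext x
      induction x using List.reverseRecOn with
      | nil => simpa [sigma13] using h
      | append_singleton x i ih =>
        have hx := hσ x i
        rcases Nat.mod_two_eq_zero_or_one x.length with hl | hl <;>
          simp_all [sigma13, Nat.add_mod]
    · right
      funext x
      induction x using List.reverseRecOn with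
      | nil => simpa [sigma31] using h
      | append_singleton x i ih =>
        have hx := hσ x i
        rcases Nat.mod_two_eq_zero_or_one x.length with hl | hl <;>
          simp_all [sigma31, Nat.add_mod]
end

section
/- Assume a = b ≤ c. Then for every integer n ≥ 2 there exists a G_n-periodic ground state; explicitly, for n = 2m the configuration σ_{[1,(2,3),…,(2,3),2]} (level sequence of period 2m: k_0 = 1, then the block (2,3) repeated m−1 times, then 2) is a G_{2m}-periodic ground state, and for n = 2m+1 the configuration σ_{[1,(2,3),…,(2,3)]} (level sequence of period 2m+1: k_0 = 1 followed by the block (2,3) repeated m times) is a G_{2m+1}-periodic ground state. -/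
/-- The configuration with `n`-periodic level sequence `1, 2, 3, 2, 3, …`
(i.e. `k_0 = 1`, `k_j = 2` for odd `j`, `k_j = 3` for even `j ≠ 0`); for
`n = 2m` this is `σ_{[1,(2,3),…,(2,3),2]}` and for `n = 2m+1` this is
`σ_{[1,(2,3),…,(2,3)]}`. -/
def sigmaA2 (n : ℕ) : Config := fun x =>
  if x.length % n = 0 then 0 else if (x.length % n) % 2 = 1 then 1 else 2

theorem sigmaA2_gPeriodic (n : ℕ) : GPeriodic n (sigmaA2 n) := by
  rintro g x ⟨k, hk⟩
  simp [sigmaA2, hk]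

/-- For `n ≥ 2`, consecutive levels of `sigmaA2 n` carry distinct spins. -/
theorem sigmaA2_ne_sigmaA2_append_singleton {n : ℕ} (hn : 2 ≤ n) (x : Vertex) (i : Fin 2) :
    sigmaA2 n x ≠ sigmaA2 n (x ++ [i]) := by
  have hsucc : (x.length + 1) % n = if x.length % n + 1 = n then 0 else x.length % n + 1 := by
    rw [Nat.add_mod, Nat.mod_eq_of_lt (show 1 < n by omega)]
    split_ifs with h
    · rw [h, Nat.mod_self]
    · exact Nat.mod_eq_of_lt (by have := Nat.mod_lt x.length (show 0 < n by omega); omega)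
  simp only [sigmaA2, List.length_append, List.length_singleton, hsucc]
  clear hsucc
  generalize x.length % n = r
  by_cases hlast : r + 1 = n <;> simp only [hlast, if_true, if_false] <;>
    split_ifs <;> first | decide | (exfalso; omega)

theorem lam_self_left_of_ne (a c : ℝ) {i j : Fin 3} (hij : i ≠ j) : lam a a c i j = a := by
  fin_cases i <;> fin_cases j <;> simp_all [lam]

theorem minEnergy_self_left {a c : ℝ} (hac : a ≤ c) : minEnergy a a c = a := by
  refine IsLeast.csInf_eq ⟨⟨a, by simp, a, by simp, by ring⟩, ?_⟩
  have hle : ∀ α ∈ ({a, a, c} : Set ℝ), a ≤ α := by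
    rintro α (rfl | rfl | rfl) <;> simp [hac]
  rintro u ⟨α, hα, β, hβ, rfl⟩
  linarith [hle α hα, hle β hβ]

/-- if `a = b ≤ c`, then for every `n ≥ 2` the above configuration is a
`G_n`-periodic ground state (hence such a ground state exists for every `n ≥ 2`). -/
theorem stmt2 (a b c : ℝ) (hab : a = b) (hbc : b ≤ c) :
    ∀ n : ℕ, 2 ≤ n →
      GPeriodic n (sigmaA2 n) ∧ IsGroundState a b c (sigmaA2 n) := by
  subst hab
  intro n hn
  refine ⟨sigmaA2_gPeriodic n, fun x => ?_⟩
  rw [ballEnergy, minEnergy_self_left hbc,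
    lam_self_left_of_ne a c (sigmaA2_ne_sigmaA2_append_singleton hn x 0),
    lam_self_left_of_ne a c (sigmaA2_ne_sigmaA2_append_singleton hn x 1)]
  ring
end

section
/- Assume a = b ≤ c. For every sequence t : ℕ → {1,2,3} with t_n ≠ t_{n+1} for all n, the configuration σ defined by σ(x) = t_{|x|} is a ground state. In particular, the set of ground states of the λ-model is uncountable. -/
theorem lam_of_ne (b c : ℝ) {i j : Fin 3} (h : i ≠ j) : lam b b c i j = b := by
  fin_cases i <;> fin_cases j <;> simp_all [lam]

theorem minEnergy_of_le {b c : ℝ} (hbc : b ≤ c) : minEnergy b b c = b := by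
  refine IsLeast.csInf_eq ⟨⟨b, by simp, b, by simp, by ring⟩, ?_⟩
  rintro u ⟨α, hα, β, hβ, rfl⟩
  have le_of_mem : ∀ γ ∈ ({b, b, c} : Set ℝ), b ≤ γ := by
    rintro γ (rfl | rfl | rfl)
    exacts [le_rfl, le_rfl, hbc]
  linarith [le_of_mem α hα, le_of_mem β hβ]

theorem isGroundState_of_ne_succ {b c : ℝ} (hbc : b ≤ c) (t : ℕ → Fin 3)
    (ht : ∀ n, t n ≠ t (n + 1)) : IsGroundState b b c (fun x => t x.length) := by
  intro x
  simp [ballEnergy, minEnergy_of_le hbc, lam_of_ne b c (ht x.length)]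

/-- The sequence that is `0` at even indices and encodes `s` by the values `1, 2` at odd ones. -/
def oddCode (s : ℕ → Bool) (n : ℕ) : Fin 3 :=
  if n % 2 = 0 then 0 else if s (n / 2) then 1 else 2

theorem oddCode_ne_succ (s : ℕ → Bool) (n : ℕ) : oddCode s n ≠ oddCode s (n + 1) := by
  unfold oddCode
  rcases Nat.mod_two_eq_zero_or_one n with h | h
  · have h' : (n + 1) % 2 = 1 := by omega
    cases s ((n + 1) / 2) <;> simp [h, h']
  · have h' : (n + 1) % 2 = 0 := by omega
    cases s (n / 2) <;> simp [h, h']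

theorem oddCode_injective : Function.Injective oddCode := by
  intro s s' h
  funext n
  have hn := congrFun h (2 * n + 1)
  have h₁ : (2 * n + 1) % 2 = 1 := by omega
  have h₂ : (2 * n + 1) / 2 = n := by omega
  cases hs : s n <;> cases hs' : s' n <;> simp_all [oddCode]

theorem comp_length_injective :
    Function.Injective (fun (t : ℕ → Fin 3) (x : Vertex) => t x.length) := by
  intro t t' h
  funext n
  simpa using congrFun h (List.replicate n 0)

theorem not_countable_natToBool : ¬ Countable (ℕ → Bool) := by
  intro h
  obtain ⟨f, hf⟩ := h.exists_injective_nat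
  exact Function.cantor_injective (fun s : Set ℕ => f (fun n => by classical exact decide (n ∈ s)))
    (fun s s' hs => by
      ext n
      simpa using congrFun (hf hs) n)

/-- if `a = b ≤ c`, then for every sequence `t : ℕ → {1,2,3}` with
`t n ≠ t (n+1)` the configuration `σ(x) = t_{|x|}` is a ground state, and the set of
ground states is uncountable. -/
theorem stmt3 (a b c : ℝ) (hab : a = b) (hbc : b ≤ c) :
    (∀ t : ℕ → Fin 3, (∀ n : ℕ, t n ≠ t (n + 1)) →
      IsGroundState a b c (fun x => t x.length)) ∧
    ¬ {σ : Config | IsGroundState a b c σ}.Countable := by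
  subst hab
  refine ⟨fun t ht => isGroundState_of_ne_succ hbc t ht, fun hcount => ?_⟩
  refine not_countable_natToBool (Set.countable_univ_iff.mp ?_)
  exact Set.MapsTo.countable_of_injOn
    (fun s _ => isGroundState_of_ne_succ hbc (oddCode s) (oddCode_ne_succ s))
    (comp_length_injective.comp oddCode_injective).injOn hcount
end

section
/- Assume a = c ≤ b. Then for every integer n ≥ 1 the configuration σ_{[1,3,3,…,3]} (level sequence of period n: k_0 = 1 and k_1 = ⋯ = k_{n−1} = 3) is a G_n-periodic ground state of the λ-model. -/
/-- The configuration `σ_{[1,3,3,…,3]}` with period `n`: spin 1 on levels divisible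
by `n`, spin 3 elsewhere. -/
def sigmaA3 (n : ℕ) : Config := fun x =>
  if x.length % n = 0 then 0 else 2

/-- Spins 1 and 3 interact only through `a` and `c`. -/
lemma lam_sigmaA3 (a b : ℝ) (n : ℕ) (x y : Vertex) :
    lam a b a (sigmaA3 n x) (sigmaA3 n y) = a := by
  unfold sigmaA3
  split_ifs <;> simp [lam]

lemma minEnergy_eq_of_le {a b : ℝ} (hab : a ≤ b) : minEnergy a b a = a := by
  refine IsLeast.csInf_eq ⟨⟨a, by simp, a, by simp, by ring⟩, ?_⟩
  have le_of_mem : ∀ α ∈ ({a, b, a} : Set ℝ), a ≤ α := by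
    rintro α (rfl | rfl | rfl)
    exacts [le_rfl, hab, le_rfl]
  rintro u ⟨α, hα, β, hβ, rfl⟩
  linarith [le_of_mem α hα, le_of_mem β hβ]

/-- if `a = c ≤ b`, then for every `n ≥ 1` the configuration
`σ_{[1,3,3,…,3]}` is a `G_n`-periodic ground state. -/
theorem stmt5 (a b c : ℝ) (hac : a = c) (hcb : c ≤ b) :
    ∀ n : ℕ, 1 ≤ n →
      GPeriodic n (sigmaA3 n) ∧ IsGroundState a b c (sigmaA3 n) := by
  intro n _
  subst hac
  refine ⟨fun g x h => ?_, fun x => ?_⟩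
  · obtain ⟨k, hk⟩ := h
    simp [sigmaA3, hk]
  · rw [minEnergy_eq_of_le hcb, ballEnergy, lam_sigmaA3, lam_sigmaA3]
    ring
end

section
/- Assume b = c ≤ a. Then for every integer n ≥ 1 the configuration σ_{[1,2,2,…,2]} (level sequence of period n: k_0 = 1 and k_1 = ⋯ = k_{n−1} = 2) is a G_n-periodic ground state of the λ-model. -/
/-- The configuration `σ_{[1,2,2,…,2]}` with period `n`: spin 1 on levels divisible
by `n`, spin 2 elsewhere. -/
def sigmaA5 (n : ℕ) : Config := fun x =>
  if x.length % n = 0 then 0 else 1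

theorem minEnergy_eq_of_le_s8 {a c : ℝ} (hca : c ≤ a) : minEnergy a c c = c := by
  refine IsLeast.csInf_eq ⟨⟨c, by simp, c, by simp, by ring⟩, ?_⟩
  rintro u ⟨α, hα, β, hβ, rfl⟩
  have le_of_mem : ∀ γ ∈ ({a, c, c} : Set ℝ), c ≤ γ := by
    rintro γ (rfl | rfl | rfl)
    exacts [hca, le_rfl, le_rfl]
  linarith [le_of_mem α hα, le_of_mem β hβ]

theorem gPeriodic_sigmaA5 (n : ℕ) : GPeriodic n (sigmaA5 n) := by
  rintro g x ⟨k, hk⟩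
  simp [sigmaA5, hk]

theorem lam_sigmaA5 (a c : ℝ) (n : ℕ) (x y : Vertex) :
    lam a c c (sigmaA5 n x) (sigmaA5 n y) = c := by
  unfold sigmaA5
  split_ifs <;> simp [lam]

/-- if `b = c ≤ a`, then for every `n ≥ 1` the configuration
`σ_{[1,2,2,…,2]}` is a `G_n`-periodic ground state. -/
theorem stmt8 (a b c : ℝ) (hbc : b = c) (hca : c ≤ a) :
    ∀ n : ℕ, 1 ≤ n →
      GPeriodic n (sigmaA5 n) ∧ IsGroundState a b c (sigmaA5 n) := by
  subst hbc
  intro n _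
  refine ⟨gPeriodic_sigmaA5 n, fun x => ?_⟩
  rw [minEnergy_eq_of_le_s8 hca, ballEnergy, lam_sigmaA5, lam_sigmaA5]
  ring
end

section
/- The sequence of measures (μ^{(n)})_{n≥1} is consistent if and only if for every vertex x ∈ V and every k ∈ {1,…,q−1} the following equation holds: u_{k,x} = ∏_{y ∈ S(x)} [ ( Σ_{j=1}^{q−1} exp(β λ(k,j)) u_{j,y} + exp(β λ(k,q)) ) / ( Σ_{j=1}^{q−1} exp(β λ(q,j)) u_{j,y} + exp(β λ(q,q)) ) ], where u_{j,y} = exp(h_{j,y} − h_{q,y}). -/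
/-!
The semi-infinite Cayley tree of order `K` has vertex set the finite words over
`Fin K` (the root is the empty word); the direct successors of `x` are the words
`x ++ [i]`, `i : Fin K`.  Spins take values in `Fin (r + 2)` (so `q = r + 2 ≥ 2`
spin values; the value `Fin.last (r + 1)` plays the role of the `q`-th spin).
-/

/-- The finset of words of length exactly `n` over `Fin K` (the sphere `W_n`). -/
def wordsLen (K : ℕ) : ℕ → Finset (List (Fin K))
  | 0 => {([] : List (Fin K))}
  | n + 1 => (Finset.univ ×ˢ wordsLen K n).image fun p => p.1 :: p.2

/-- The finset of words of length at most `n` (the ball `V_n`). -/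
def Vball (K n : ℕ) : Finset (List (Fin K)) :=
  (Finset.range (n + 1)).biUnion (wordsLen K)

/-- `H_n(σ) = Σ_{⟨x,y⟩ ∈ L_n} λ(σ(x), σ(y))`: the sum is over all edges with both
endpoints in `V_n`, i.e. over pairs `(x, x ++ [i])` with `|x| < n`. -/
def Hn (K r : ℕ) (lam : Fin (r + 2) → Fin (r + 2) → ℝ) (n : ℕ)
    (σ : List (Fin K) → Fin (r + 2)) : ℝ :=
  ∑ x ∈ (Vball K n).filter (fun w => w.length < n), ∑ i : Fin K,
    lam (σ x) (σ (x ++ [i]))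

/-- The unnormalized Gibbs weight `exp(β H_n(σ) + Σ_{x ∈ W_n} h_{σ(x),x})`. -/
noncomputable def gibbsWeight (K r : ℕ) (β : ℝ)
    (lam : Fin (r + 2) → Fin (r + 2) → ℝ)
    (h : List (Fin K) → Fin (r + 2) → ℝ) (n : ℕ)
    (σ : List (Fin K) → Fin (r + 2)) : ℝ :=
  Real.exp (β * Hn K r lam n σ + ∑ x ∈ wordsLen K n, h x (σ x))

/-- The partition function `Z_n`: the sum of the weights over all configurations
on `V_n`. -/
noncomputable def Zn (K r : ℕ) (β : ℝ)
    (lam : Fin (r + 2) → Fin (r + 2) → ℝ)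
    (h : List (Fin K) → Fin (r + 2) → ℝ) (n : ℕ) : ℝ :=
  ∑ g : {x // x ∈ Vball K n} → Fin (r + 2),
    gibbsWeight K r β lam h n
      (fun x => if hx : x ∈ Vball K n then g ⟨x, hx⟩ else 0)

/-- The finite-dimensional distribution `μ⁽ⁿ⁾(σ) = Z_n⁻¹ exp(β H_n(σ) + Σ_{x ∈ W_n}
h_{σ(x),x})` (as a function of full configurations; it depends only on the
restriction of `σ` to `V_n`). -/
noncomputable def mu (K r : ℕ) (β : ℝ)
    (lam : Fin (r + 2) → Fin (r + 2) → ℝ)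
    (h : List (Fin K) → Fin (r + 2) → ℝ) (n : ℕ)
    (σ : List (Fin K) → Fin (r + 2)) : ℝ :=
  gibbsWeight K r β lam h n σ / Zn K r β lam h n

/-- Consistency: for all `n ≥ 1` and all configurations `σ` (on `V_{n-1}`),
`Σ_{ω : W_n → spins} μ⁽ⁿ⁾(σ ∨ ω) = μ⁽ⁿ⁻¹⁾(σ)`. -/
noncomputable def Consistent (K r : ℕ) (β : ℝ)
    (lam : Fin (r + 2) → Fin (r + 2) → ℝ)
    (h : List (Fin K) → Fin (r + 2) → ℝ) : Prop :=
  ∀ n : ℕ, 1 ≤ n → ∀ σ : List (Fin K) → Fin (r + 2),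
    (∑ ω : {x // x ∈ wordsLen K n} → Fin (r + 2),
      mu K r β lam h n
        (fun x => if hx : x ∈ wordsLen K n then ω ⟨x, hx⟩ else σ x)) =
    mu K r β lam h (n - 1) σ

/-- `u_{k,x} = exp(h_{k,x} − h_{q,x})` for `k = 1, …, q − 1`. -/
noncomputable def uCoord (K r : ℕ) (h : List (Fin K) → Fin (r + 2) → ℝ)
    (k : Fin (r + 1)) (x : List (Fin K)) : ℝ :=
  Real.exp (h x k.castSucc - h x (Fin.last (r + 1)))

lemma mem_wordsLen_iff {K n : ℕ} {w : List (Fin K)} : w ∈ wordsLen K n ↔ w.length = n := by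
  induction n generalizing w with
  | zero => simp [wordsLen]
  | succ n ih => cases w <;> simp [wordsLen, ih]

lemma mem_Vball_iff {K n : ℕ} {w : List (Fin K)} : w ∈ Vball K n ↔ w.length ≤ n := by
  simp [Vball, mem_wordsLen_iff]

lemma filter_Vball_succ (K n : ℕ) :
    (Vball K (n + 1)).filter (fun w => w.length < n + 1) =
      (Vball K n).filter (fun w => w.length < n) ∪ wordsLen K n := by
  ext w
  simp only [Finset.mem_filter, Finset.mem_union, mem_Vball_iff, mem_wordsLen_iff]
  omega

/-- Every word of length `n + 1` is uniquely a direct successor of a word of length `n`. -/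
lemma prod_wordsLen_succ {M : Type*} [CommMonoid M] (K n : ℕ) (f : List (Fin K) → M) :
    ∏ y ∈ wordsLen K (n + 1), f y = ∏ x ∈ wordsLen K n, ∏ i : Fin K, f (x ++ [i]) := by
  rw [← Finset.prod_product']
  symm
  refine Finset.prod_bij (fun p _ => p.1 ++ [p.2]) ?_ ?_ ?_ (fun _ _ => rfl)
  · rintro ⟨x, i⟩ hx
    simp_all [mem_wordsLen_iff]
  · rintro ⟨x, i⟩ - ⟨y, j⟩ - hxy
    simpa [← List.concat_eq_append, List.concat_inj] using hxy
  · intro y hy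
    rw [mem_wordsLen_iff] at hy
    have hne : y ≠ [] := by rintro rfl; simp at hy
    refine ⟨(y.dropLast, y.getLast hne), ?_, List.dropLast_append_getLast hne⟩
    simp [mem_wordsLen_iff, hy]

section Gibbs

variable {K r : ℕ} {β : ℝ} {lam : Fin (r + 2) → Fin (r + 2) → ℝ}
  {h : List (Fin K) → Fin (r + 2) → ℝ}

lemma Hn_succ (n : ℕ) (σ : List (Fin K) → Fin (r + 2)) :
    Hn K r lam (n + 1) σ =
      Hn K r lam n σ + ∑ x ∈ wordsLen K n, ∑ i : Fin K, lam (σ x) (σ (x ++ [i])) := by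
  rw [Hn, filter_Vball_succ, Finset.sum_union, Hn]
  rw [Finset.disjoint_left]
  intro w hw
  simp only [Finset.mem_filter] at hw
  rw [mem_wordsLen_iff]
  omega

lemma Hn_congr {n : ℕ} {σ τ : List (Fin K) → Fin (r + 2)}
    (hστ : ∀ x, x.length ≤ n → σ x = τ x) : Hn K r lam n σ = Hn K r lam n τ := by
  refine Finset.sum_congr rfl fun x hx => Finset.sum_congr rfl fun i _ => ?_
  have hx := (Finset.mem_filter.1 hx).2
  rw [hστ x hx.le, hστ (x ++ [i]) (by simpa using hx)]

variable (β lam h) in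
/-- The Boltzmann factor of a vertex with spin `s`, summed over the spin of its successor `y`. -/
noncomputable def edgeSum (s : Fin (r + 2)) (y : List (Fin K)) : ℝ :=
  ∑ t, Real.exp (β * lam s t + h y t)

lemma edgeSum_pos (s : Fin (r + 2)) (y : List (Fin K)) : 0 < edgeSum β lam h s y :=
  Finset.sum_pos (fun _ _ => Real.exp_pos _) Finset.univ_nonempty

variable (β lam h) in
/-- The Boltzmann factor of a vertex `x` with spin `s`, summed over the spins of all
its successors. -/
noncomputable def childProd (s : Fin (r + 2)) (x : List (Fin K)) : ℝ :=
  ∏ i : Fin K, edgeSum β lam h s (x ++ [i])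

lemma childProd_pos (s : Fin (r + 2)) (x : List (Fin K)) : 0 < childProd β lam h s x :=
  Finset.prod_pos fun _ _ => edgeSum_pos _ _

lemma gibbsWeight_eq (n : ℕ) (σ : List (Fin K) → Fin (r + 2)) :
    gibbsWeight K r β lam h n σ =
      Real.exp (β * Hn K r lam n σ) * ∏ x ∈ wordsLen K n, Real.exp (h x (σ x)) := by
  rw [gibbsWeight, Real.exp_add, Real.exp_sum]

/-- Summing out the spins of the outermost sphere. -/
lemma sum_gibbsWeight_succ (n : ℕ) (σ : List (Fin K) → Fin (r + 2)) :
    (∑ ω : {x // x ∈ wordsLen K (n + 1)} → Fin (r + 2),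
      gibbsWeight K r β lam h (n + 1)
        (fun x => if hx : x ∈ wordsLen K (n + 1) then ω ⟨x, hx⟩ else σ x)) =
    Real.exp (β * Hn K r lam n σ) * ∏ x ∈ wordsLen K n, childProd β lam h (σ x) x := by
  have key : ∏ x ∈ wordsLen K n, childProd β lam h (σ x) x =
      ∏ y : {y // y ∈ wordsLen K (n + 1)}, ∑ t,
        Real.exp (β * lam (σ y.1.dropLast) t + h y.1 t) := by
    rw [Finset.prod_coe_sort (wordsLen K (n + 1))
      (fun y => ∑ t, Real.exp (β * lam (σ y.dropLast) t + h y t)), prod_wordsLen_succ]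
    simp [childProd, edgeSum]
  rw [key, Finset.prod_univ_sum, Fintype.piFinset_univ, Finset.mul_sum]
  refine Finset.sum_congr rfl fun ω _ => ?_
  set τ : List (Fin K) → Fin (r + 2) :=
    fun x => if hx : x ∈ wordsLen K (n + 1) then ω ⟨x, hx⟩ else σ x with hτ
  have hτσ : ∀ x : List (Fin K), x.length ≤ n → τ x = σ x := by
    intro x hx
    rw [hτ]
    exact dif_neg (by rw [mem_wordsLen_iff]; omega)
  have hτω : ∀ y : {y // y ∈ wordsLen K (n + 1)}, ω y = τ y.1 := by
    intro y
    simp [hτ]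
  simp_rw [hτω]
  rw [Finset.prod_coe_sort (wordsLen K (n + 1))
    (fun y => Real.exp (β * lam (σ y.dropLast) (τ y) + h y (τ y)))]
  simp_rw [Real.exp_add]
  rw [Finset.prod_mul_distrib, gibbsWeight_eq, Hn_succ, Hn_congr hτσ, mul_add, Real.exp_add,
    mul_assoc]
  congr 2
  rw [prod_wordsLen_succ, Finset.mul_sum, Real.exp_sum]
  refine Finset.prod_congr rfl fun x hx => ?_
  rw [Finset.mul_sum, Real.exp_sum]
  refine Finset.prod_congr rfl fun i _ => ?_
  rw [hτσ x (mem_wordsLen_iff.1 hx).le, List.dropLast_concat]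

lemma Zn_pos (n : ℕ) : 0 < Zn K r β lam h n :=
  Finset.sum_pos (fun _ _ => Real.exp_pos _) Finset.univ_nonempty

/-- A configuration on `V_{n+1}` is a configuration on `V_n` together with one on `W_{n+1}`. -/
lemma Zn_succ (n : ℕ) :
    Zn K r β lam h (n + 1) = ∑ g : {x // x ∈ Vball K n} → Fin (r + 2),
      ∑ ω : {x // x ∈ wordsLen K (n + 1)} → Fin (r + 2),
        gibbsWeight K r β lam h (n + 1)
          (fun x => if hx : x ∈ wordsLen K (n + 1) then ω ⟨x, hx⟩ else
            if hx : x ∈ Vball K n then g ⟨x, hx⟩ else 0) := by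
  have hmem : ∀ x : List (Fin K),
      x ∈ Vball K (n + 1) ↔ x ∈ wordsLen K (n + 1) ∨ x ∈ Vball K n := by
    intro x
    simp only [mem_Vball_iff, mem_wordsLen_iff]
    omega
  have hdisj : ∀ x : List (Fin K), x ∈ Vball K n → x ∉ wordsLen K (n + 1) := by
    intro x
    simp only [mem_Vball_iff, mem_wordsLen_iff]
    omega
  rw [← Fintype.sum_prod_type', Zn]
  refine Fintype.sum_equiv
    { toFun := fun g => (fun x => g ⟨x.1, (hmem _).2 (.inr x.2)⟩,
        fun x => g ⟨x.1, (hmem _).2 (.inl x.2)⟩)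
      invFun := fun p x => if hx : x.1 ∈ wordsLen K (n + 1) then p.2 ⟨x.1, hx⟩ else
        p.1 ⟨x.1, ((hmem _).1 x.2).resolve_left hx⟩
      left_inv := fun g => by
        ext x
        dsimp only
        split_ifs <;> rfl
      right_inv := fun p => by
        refine Prod.ext (funext fun x => ?_) (funext fun x => ?_)
        · exact dif_neg (hdisj _ x.2)
        · exact dif_pos x.2 } _ _ fun g => ?_
  congr 1
  funext x
  by_cases h₁ : x ∈ wordsLen K (n + 1)
  · simp [h₁, hmem]
  · by_cases h₂ : x ∈ Vball K n <;> simp [h₁, h₂, hmem]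

/-- Consistency, after cancelling the energy of the inner ball. -/
lemma consistent_iff :
    Consistent K r β lam h ↔ ∀ (n : ℕ) (σ : List (Fin K) → Fin (r + 2)),
      (∏ x ∈ wordsLen K n, childProd β lam h (σ x) x) / Zn K r β lam h (n + 1) =
        (∏ x ∈ wordsLen K n, Real.exp (h x (σ x))) / Zn K r β lam h n := by
  have step : ∀ (n : ℕ) (σ : List (Fin K) → Fin (r + 2)),
      (∑ ω : {x // x ∈ wordsLen K (n + 1)} → Fin (r + 2),
        mu K r β lam h (n + 1)
          (fun x => if hx : x ∈ wordsLen K (n + 1) then ω ⟨x, hx⟩ else σ x)) =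
        mu K r β lam h n σ ↔
      (∏ x ∈ wordsLen K n, childProd β lam h (σ x) x) / Zn K r β lam h (n + 1) =
        (∏ x ∈ wordsLen K n, Real.exp (h x (σ x))) / Zn K r β lam h n := by
    intro n σ
    simp only [mu]
    rw [← Finset.sum_div, sum_gibbsWeight_succ, gibbsWeight_eq, mul_div_assoc, mul_div_assoc,
      mul_right_inj' (Real.exp_pos _).ne']
  constructor
  · intro hc n σ
    exact (step n σ).1 (hc (n + 1) (by omega) σ)
  · intro hc n hn σ
    obtain ⟨m, rfl⟩ := Nat.exists_eq_add_of_le' hn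
    exact (step m σ).2 (hc m σ)

lemma consistent_iff_childProd :
    Consistent K r β lam h ↔ ∀ (x : List (Fin K)) (s t : Fin (r + 2)),
      childProd β lam h s x * Real.exp (h x t) = childProd β lam h t x * Real.exp (h x s) := by
  rw [consistent_iff]
  constructor
  · intro hc x s t
    have hx : x ∈ wordsLen K x.length := mem_wordsLen_iff.2 rfl
    have hrest : ∀ v, ∀ f : Fin (r + 2) → List (Fin K) → ℝ,
        ∏ y ∈ wordsLen K x.length, f (Function.update (fun _ => t) x v y) y =
          f v x * ∏ y ∈ (wordsLen K x.length).erase x, f t y := by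
      intro v f
      rw [← Finset.mul_prod_erase _ _ hx, Function.update_self]
      congr 1
      refine Finset.prod_congr rfl fun y hy => ?_
      rw [Function.update_of_ne (Finset.ne_of_mem_erase hy)]
    have e : ∀ v, _ := fun v => hc x.length (Function.update (fun _ => t) x v)
    simp only [hrest _ (fun s y => childProd β lam h s y),
      hrest _ (fun s y => Real.exp (h y s))] at e
    have es := e s
    have et := e t
    have hP : 0 < ∏ y ∈ (wordsLen K x.length).erase x, childProd β lam h t y :=
      Finset.prod_pos fun _ _ => childProd_pos _ _
    have hQ : 0 < ∏ y ∈ (wordsLen K x.length).erase x, Real.exp (h y t) :=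
      Finset.prod_pos fun _ _ => Real.exp_pos _
    have hZ := Zn_pos (K := K) (r := r) (β := β) (lam := lam) (h := h) x.length
    have hZ' := Zn_pos (K := K) (r := r) (β := β) (lam := lam) (h := h) (x.length + 1)
    rw [div_eq_div_iff hZ'.ne' hZ.ne'] at es et
    refine mul_right_cancel₀ (mul_pos (mul_pos hP hQ) (mul_pos hZ hZ')).ne' ?_
    linear_combination Real.exp (h x t) * (∏ y ∈ (wordsLen K x.length).erase x,
        Real.exp (h y t)) * Zn K r β lam h (x.length + 1) * es -
      Real.exp (h x s) * (∏ y ∈ (wordsLen K x.length).erase x,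
        Real.exp (h y t)) * Zn K r β lam h (x.length + 1) * et
  · intro hc n
    set A : ℝ := ∏ x ∈ wordsLen K n, childProd β lam h 0 x / Real.exp (h x 0) with hA
    have hApos : 0 < A := Finset.prod_pos fun _ _ => div_pos (childProd_pos _ _) (Real.exp_pos _)
    have hprod : ∀ σ : List (Fin K) → Fin (r + 2),
        ∏ x ∈ wordsLen K n, childProd β lam h (σ x) x =
          A * ∏ x ∈ wordsLen K n, Real.exp (h x (σ x)) := by
      intro σ
      rw [hA, ← Finset.prod_mul_distrib]
      refine Finset.prod_congr rfl fun x _ => ?_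
      rw [div_mul_eq_mul_div, eq_div_iff (Real.exp_pos _).ne', hc]
    have hZ : Zn K r β lam h (n + 1) = A * Zn K r β lam h n := by
      rw [Zn_succ, Zn, Finset.mul_sum]
      refine Finset.sum_congr rfl fun g _ => ?_
      rw [sum_gibbsWeight_succ, hprod, gibbsWeight_eq]
      ring
    intro σ
    rw [hprod, hZ, mul_div_mul_left _ _ hApos.ne']

lemma edgeSum_eq (s : Fin (r + 2)) (y : List (Fin K)) :
    edgeSum β lam h s y = Real.exp (h y (Fin.last (r + 1))) *
      ((∑ j : Fin (r + 1), Real.exp (β * lam s j.castSucc) * uCoord K r h j y) +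
        Real.exp (β * lam s (Fin.last (r + 1)))) := by
  rw [edgeSum, Fin.sum_univ_castSucc, mul_add, Finset.mul_sum]
  congr 1
  · refine Finset.sum_congr rfl fun j _ => ?_
    rw [uCoord, ← Real.exp_add, ← Real.exp_add]
    ring_nf
  · rw [← Real.exp_add, add_comm]

end Gibbs

/-- the sequence `(μ⁽ⁿ⁾)` is consistent iff for every vertex `x` and
every `k ∈ {1, …, q−1}`:
`u_{k,x} = ∏_{y ∈ S(x)} (Σ_{j=1}^{q-1} e^{βλ(k,j)} u_{j,y} + e^{βλ(k,q)}) /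
(Σ_{j=1}^{q-1} e^{βλ(q,j)} u_{j,y} + e^{βλ(q,q)})`. -/
theorem stmt11 (K r : ℕ) (hK : 1 ≤ K) (β : ℝ) (hβ : 0 < β)
    (lam : Fin (r + 2) → Fin (r + 2) → ℝ)
    (hsym : ∀ i j, lam i j = lam j i)
    (h : List (Fin K) → Fin (r + 2) → ℝ) :
    Consistent K r β lam h ↔
      ∀ (x : List (Fin K)) (k : Fin (r + 1)),
        uCoord K r h k x =
          ∏ i : Fin K,
            ((∑ j : Fin (r + 1),
                Real.exp (β * lam k.castSucc j.castSucc) * uCoord K r h j (x ++ [i])) +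
              Real.exp (β * lam k.castSucc (Fin.last (r + 1)))) /
            ((∑ j : Fin (r + 1),
                Real.exp (β * lam (Fin.last (r + 1)) j.castSucc) * uCoord K r h j (x ++ [i])) +
              Real.exp (β * lam (Fin.last (r + 1)) (Fin.last (r + 1)))) := by
  rw [consistent_iff_childProd]
  have hrec : ∀ (x : List (Fin K)) (k : Fin (r + 1)),
      (uCoord K r h k x =
          ∏ i : Fin K,
            ((∑ j : Fin (r + 1),
                Real.exp (β * lam k.castSucc j.castSucc) * uCoord K r h j (x ++ [i])) +
              Real.exp (β * lam k.castSucc (Fin.last (r + 1)))) /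
            ((∑ j : Fin (r + 1),
                Real.exp (β * lam (Fin.last (r + 1)) j.castSucc) * uCoord K r h j (x ++ [i])) +
              Real.exp (β * lam (Fin.last (r + 1)) (Fin.last (r + 1))))) ↔
        childProd β lam h k.castSucc x * Real.exp (h x (Fin.last (r + 1))) =
          childProd β lam h (Fin.last (r + 1)) x * Real.exp (h x k.castSucc) := by
    intro x k
    have hquot : ∀ i : Fin K,
        ((∑ j : Fin (r + 1),
            Real.exp (β * lam k.castSucc j.castSucc) * uCoord K r h j (x ++ [i])) +
          Real.exp (β * lam k.castSucc (Fin.last (r + 1)))) /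
        ((∑ j : Fin (r + 1),
            Real.exp (β * lam (Fin.last (r + 1)) j.castSucc) * uCoord K r h j (x ++ [i])) +
          Real.exp (β * lam (Fin.last (r + 1)) (Fin.last (r + 1)))) =
        edgeSum β lam h k.castSucc (x ++ [i]) /
          edgeSum β lam h (Fin.last (r + 1)) (x ++ [i]) := by
      intro i
      rw [edgeSum_eq, edgeSum_eq, mul_div_mul_left _ _ (Real.exp_pos _).ne']
    rw [Finset.prod_congr rfl fun i _ => hquot i, Finset.prod_div_distrib, uCoord, Real.exp_sub]
    change _ = childProd β lam h k.castSucc x / childProd β lam h (Fin.last (r + 1)) x ↔ _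
    rw [div_eq_div_iff (Real.exp_pos _).ne' (childProd_pos _ _).ne',
      mul_comm (Real.exp (h x k.castSucc))]
    exact eq_comm
  simp_rw [hrec]
  refine ⟨fun hc x k => hc x _ _, fun hc x => ?_⟩
  have hlast : ∀ s, childProd β lam h s x * Real.exp (h x (Fin.last (r + 1))) =
      childProd β lam h (Fin.last (r + 1)) x * Real.exp (h x s) :=
    Fin.lastCases rfl (hc x)
  intro s t
  refine mul_right_cancel₀ (Real.exp_pos (h x (Fin.last (r + 1)))).ne' ?_
  linear_combination Real.exp (h x t) * hlast s - Real.exp (h x s) * hlast t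
end

section
/- Let a > 0 and 0 < b ≤ 9. Then the equation a·x = ((1+x)/(b+x))² has exactly one solution x > 0. -/
lemma strictMonoOn_mul_add_sq_div {b : ℝ} (hb : 0 ≤ b) (hb9 : b ≤ 9) :
    StrictMonoOn (fun s : ℝ => s * (b + s ^ 2) / (1 + s ^ 2)) (Set.Ici 0) := by
  intro s hs t ht hst
  rw [Set.mem_Ici] at hs ht
  have hp : 0 ≤ s * t := mul_nonneg hs ht
  have hquad : 0 ≤ b - b * (s * t) + 3 * (s * t) + (s * t) ^ 2 := by
    nlinarith [mul_nonneg hb (sq_nonneg (s * t - 3)),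
      mul_nonneg (sub_nonneg.2 hb9) (mul_nonneg hp (add_nonneg hp zero_le_three))]
  have hfac : 0 < b - b * (s * t) + s ^ 2 + s * t + t ^ 2 + (s * t) ^ 2 := by
    nlinarith [pow_pos (sub_pos.2 hst) 2]
  simp only
  rw [div_lt_div_iff₀ (by positivity) (by positivity)]
  nlinarith [mul_pos (sub_pos.2 hst) hfac]

lemma exists_pos_mul_eq_div_sq {a b : ℝ} (ha : 0 < a) (hb : 0 < b) :
    ∃ x : ℝ, 0 < x ∧ a * x = ((1 + x) / (b + x)) ^ 2 := by
  have hM : (0 : ℝ) ≤ 1 + 4 / a := by positivity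
  have hc : ContinuousOn (fun x : ℝ => a * x * (b + x) ^ 2 - (1 + x) ^ 2)
      (Set.Icc 0 (1 + 4 / a)) := by fun_prop
  have hend : 0 ≤ a * (1 + 4 / a) * (b + (1 + 4 / a)) ^ 2 - (1 + (1 + 4 / a)) ^ 2 := by
    have h4 : a * (1 + 4 / a) = a + 4 := by field_simp
    have hd : 0 < 4 / a := by positivity
    rw [h4]
    generalize 4 / a = d at hd
    nlinarith [mul_pos ha (pow_pos (by positivity : 0 < b + (1 + d)) 2), mul_pos hb hd,
      sq_nonneg b, sq_nonneg d]
  obtain ⟨x, ⟨hx0, -⟩, hx⟩ := intermediate_value_Icc hM hc ⟨by norm_num, hend⟩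
  simp only at hx
  have hxpos : 0 < x := by
    refine lt_of_le_of_ne hx0 ?_
    rintro rfl
    norm_num at hx
  refine ⟨x, hxpos, ?_⟩
  rw [div_pow, eq_div_iff (by positivity)]
  linarith

/-- for `a > 0` and `0 < b ≤ 9`, the equation
`a·x = ((1+x)/(b+x))²` has exactly one solution `x > 0`. -/
theorem stmt12 (a b : ℝ) (ha : 0 < a) (hb : 0 < b) (hb9 : b ≤ 9) :
    ∃! x : ℝ, 0 < x ∧ a * x = ((1 + x) / (b + x)) ^ 2 := by
  have key : ∀ x : ℝ, 0 < x → a * x = ((1 + x) / (b + x)) ^ 2 →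
      (√x * (b + √x ^ 2) / (1 + √x ^ 2)) ^ 2 = a⁻¹ := by
    intro x hx h
    rw [div_pow, eq_div_iff (by positivity)] at h
    rw [div_pow, mul_pow, Real.sq_sqrt hx.le, div_eq_iff (by positivity), ← h]
    field_simp
  obtain ⟨x, hx, hxe⟩ := exists_pos_mul_eq_div_sq ha hb
  refine ⟨x, ⟨hx, hxe⟩, ?_⟩
  rintro y ⟨hy, hye⟩
  have hsq := (key y hy hye).trans (key x hx hxe).symm
  have heq := (pow_left_inj₀ (by positivity) (by positivity) two_ne_zero).1 hsq
  exact (Real.sqrt_inj hy.le hx.le).1 <|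
    (strictMonoOn_mul_add_sq_div hb.le hb9).injOn (Real.sqrt_nonneg y) (Real.sqrt_nonneg x) heq
end

section
/- Let b > 9. Then the quadratic equation t² + (3−b)t + b = 0 has two real roots with 0 < x₁ < x₂; setting η_i = (1/x_i)·((1+x_i)/(b+x_i))² for i = 1, 2, one has 0 < η₁ < η₂, and for every a with η₁ < a < η₂ the equation a·x = ((1+x)/(b+x))² has exactly three solutions x > 0. -/
/-- A cubic with nonzero leading coefficient and three distinct roots has no further root. -/
theorem cubic_root_eq_of_three_roots {A B C D r₁ r₂ r₃ x : ℝ} (hA : A ≠ 0)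
    (h₁₂ : r₁ ≠ r₂) (h₁₃ : r₁ ≠ r₃) (h₂₃ : r₂ ≠ r₃)
    (h₁ : A * r₁ ^ 3 + B * r₁ ^ 2 + C * r₁ + D = 0)
    (h₂ : A * r₂ ^ 3 + B * r₂ ^ 2 + C * r₂ + D = 0)
    (h₃ : A * r₃ ^ 3 + B * r₃ ^ 2 + C * r₃ + D = 0)
    (hx : A * x ^ 3 + B * x ^ 2 + C * x + D = 0) :
    x = r₁ ∨ x = r₂ ∨ x = r₃ := by
  by_contra! hne
  obtain ⟨hx₁, hx₂, hx₃⟩ := hne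
  have divided {y z : ℝ} (hyz : y ≠ z) (hy : A * y ^ 3 + B * y ^ 2 + C * y + D = 0)
      (hz : A * z ^ 3 + B * z ^ 2 + C * z + D = 0) :
      A * (y ^ 2 + y * z + z ^ 2) + B * (y + z) + C = 0 :=
    mul_left_cancel₀ (sub_ne_zero.2 hyz) (by linear_combination hy - hz)
  have e₁₂ := divided h₁₂ h₁ h₂
  have s₃ : A * (r₁ + r₂ + r₃) + B = 0 :=
    mul_left_cancel₀ (sub_ne_zero.2 h₂₃) (by linear_combination e₁₂ - divided h₁₃ h₁ h₃)
  have sx : A * (r₁ + r₂ + x) + B = 0 :=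
    mul_left_cancel₀ (sub_ne_zero.2 hx₂.symm)
      (by linear_combination e₁₂ - divided hx₁.symm h₁ hx)
  exact mul_ne_zero hA (sub_ne_zero.2 hx₃) (by linear_combination sx - s₃)

/-- If the graph of `x ↦ (1 / x) * ((1 + x) / (b + x)) ^ 2` passes below the level `a` at `x₁`
and above it at some `x₂ > x₁ > 0`, then it meets this level exactly three times on `x > 0`. -/
theorem encard_setOf_mul_eq_div_sq_eq_three {a b x₁ x₂ : ℝ} (hb : 0 < b) (hx₁ : 0 < x₁)
    (hx : x₁ < x₂) (h₁ : (1 / x₁) * ((1 + x₁) / (b + x₁)) ^ 2 < a)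
    (h₂ : a < (1 / x₂) * ((1 + x₂) / (b + x₂)) ^ 2) :
    {x : ℝ | 0 < x ∧ a * x = ((1 + x) / (b + x)) ^ 2}.encard = 3 := by
  have hx₂ : 0 < x₂ := hx₁.trans hx
  have ha : 0 < a := lt_trans (by positivity) h₁
  set p : ℝ → ℝ := fun x ↦ a * x * (b + x) ^ 2 - (1 + x) ^ 2 with hp
  have hcont : Continuous p := by fun_prop
  have hroot {x : ℝ} (hx : 0 < x) : a * x = ((1 + x) / (b + x)) ^ 2 ↔ p x = 0 := by
    have : 0 < b + x := by positivity
    rw [div_pow, eq_div_iff (by positivity), hp, sub_eq_zero]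
  have hform (x : ℝ) : (1 / x) * ((1 + x) / (b + x)) ^ 2 = (1 + x) ^ 2 / (x * (b + x) ^ 2) := by
    rw [div_pow, div_mul_div_comm, one_mul]
  have hp₀ : p 0 < 0 := by simp [hp]
  have hp₁ : 0 < p x₁ := by
    rw [hform, div_lt_iff₀ (by positivity)] at h₁
    simp only [hp]
    linarith
  have hp₂ : p x₂ < 0 := by
    rw [hform, lt_div_iff₀ (by positivity)] at h₂
    simp only [hp]
    linarith
  obtain ⟨M, hM, hpM⟩ : ∃ M, x₂ < M ∧ 0 < p M := by
    have hM : 0 < x₂ + 1 + 4 / a := by positivity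
    refine ⟨x₂ + 1 + 4 / a, by linarith [show 0 < 4 / a by positivity], ?_⟩
    have haM : 4 ≤ a * (x₂ + 1 + 4 / a) := by
      have : a * (x₂ + 1 + 4 / a) = a * (x₂ + 1) + 4 := by field_simp
      nlinarith
    have hM₁ : 1 < x₂ + 1 + 4 / a := by linarith [show 0 < 4 / a by positivity]
    generalize x₂ + 1 + 4 / a = M at *
    have hbM : M ^ 2 < (b + M) ^ 2 := by nlinarith
    have := mul_le_mul_of_nonneg_right haM (sq_nonneg (b + M))
    simp only [hp]
    nlinarith
  obtain ⟨r₁, ⟨hr₁, hr₁'⟩, e₁⟩ := intermediate_value_Ioo hx₁.le hcont.continuousOn ⟨hp₀, hp₁⟩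
  obtain ⟨r₂, ⟨hr₂, hr₂'⟩, e₂⟩ := intermediate_value_Ioo' hx.le hcont.continuousOn ⟨hp₂, hp₁⟩
  obtain ⟨r₃, ⟨hr₃, -⟩, e₃⟩ := intermediate_value_Ioo hM.le hcont.continuousOn ⟨hp₂, hpM⟩
  have h₁₂ : r₁ ≠ r₂ := (hr₁'.trans hr₂).ne
  have h₂₃ : r₂ ≠ r₃ := (hr₂'.trans hr₃).ne
  have h₁₃ : r₁ ≠ r₃ := (hr₁'.trans (hx.trans hr₃)).ne
  rw [Set.encard_eq_three]
  refine ⟨r₁, r₂, r₃, h₁₂, h₁₃, h₂₃, Set.ext fun x ↦ ?_⟩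
  simp only [Set.mem_ofPred_eq, Set.mem_insert_iff, Set.mem_singleton_iff]
  constructor
  · rintro ⟨hx, h⟩
    rw [hroot hx] at h
    have expand {y : ℝ} (hy : p y = 0) :
        a * y ^ 3 + (2 * a * b - 1) * y ^ 2 + (a * b ^ 2 - 2) * y + -1 = 0 := by
      simp only [hp] at hy
      linear_combination hy
    exact cubic_root_eq_of_three_roots ha.ne' h₁₂ h₁₃ h₂₃ (expand e₁) (expand e₂) (expand e₃)
      (expand h)
  · rintro (rfl | rfl | rfl)
    · exact ⟨hr₁, (hroot hr₁).2 e₁⟩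
    · exact ⟨hx₁.trans hr₂, (hroot (hx₁.trans hr₂)).2 e₂⟩
    · exact ⟨hx₂.trans hr₃, (hroot (hx₂.trans hr₃)).2 e₃⟩

/-- Every `b > 9` has the form `(1 + 2 * s) * (1 + 2 / s)` with `0 < s < 1`. -/
theorem exists_eq_one_add_mul_one_add_div {b : ℝ} (hb : 9 < b) :
    ∃ s : ℝ, 0 < s ∧ s < 1 ∧ b = (1 + 2 * s) * (1 + 2 / s) := by
  have hd : 0 < (b - 1) * (b - 9) := mul_pos (by linarith) (by linarith)
  have hsq := Real.sq_sqrt hd.le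
  have hpos := Real.sqrt_pos.2 hd
  set d := √((b - 1) * (b - 9))
  have hs : 0 < (b - 5 - d) / 4 := by
    have : d < b - 5 := by nlinarith
    linarith
  refine ⟨(b - 5 - d) / 4, hs, ?_, ?_⟩
  · have : b - 9 < d := by nlinarith
    linarith
  · have hq : 2 * ((b - 5 - d) / 4) ^ 2 - (b - 5) * ((b - 5 - d) / 4) + 2 = 0 := by
      linear_combination hsq / 8
    generalize (b - 5 - d) / 4 = s at *
    field_simp
    linear_combination -hq

/-- for `b > 9` the quadratic `t² + (3−b)t + b = 0` has two real roots
`0 < x₁ < x₂`; with `ηᵢ = (1/xᵢ)·((1+xᵢ)/(b+xᵢ))²` one has `0 < η₁ < η₂`, and for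
every `a` with `η₁ < a < η₂` the equation `a·x = ((1+x)/(b+x))²` has exactly three
solutions `x > 0`. -/
theorem stmt13 (b : ℝ) (hb : 9 < b) :
    ∃ x₁ x₂ : ℝ, 0 < x₁ ∧ x₁ < x₂ ∧
      (∀ t : ℝ, t ^ 2 + (3 - b) * t + b = 0 ↔ t = x₁ ∨ t = x₂) ∧
      0 < (1 / x₁) * ((1 + x₁) / (b + x₁)) ^ 2 ∧
      (1 / x₁) * ((1 + x₁) / (b + x₁)) ^ 2 < (1 / x₂) * ((1 + x₂) / (b + x₂)) ^ 2 ∧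
      ∀ a : ℝ,
        (1 / x₁) * ((1 + x₁) / (b + x₁)) ^ 2 < a →
        a < (1 / x₂) * ((1 + x₂) / (b + x₂)) ^ 2 →
        {x : ℝ | 0 < x ∧ a * x = ((1 + x) / (b + x)) ^ 2}.encard = 3 := by
  obtain ⟨s, hs, hs₁, hbs⟩ := exists_eq_one_add_mul_one_add_div hb
  have hb₀ : 0 < b := by linarith
  have hx₁ : 0 < 1 + 2 * s := by positivity
  have hlt : 1 + 2 * s < 1 + 2 / s := by
    have : 2 * s < 2 / s := by
      rw [lt_div_iff₀ hs]
      nlinarith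
    linarith
  refine ⟨1 + 2 * s, 1 + 2 / s, hx₁, hlt, fun t ↦ ?_, by positivity, ?_,
    fun a h₁ h₂ ↦ encard_setOf_mul_eq_div_sq_eq_three hb₀ hx₁ hlt h₁ h₂⟩
  · have : t ^ 2 + (3 - b) * t + b = (t - (1 + 2 * s)) * (t - (1 + 2 / s)) := by
      rw [hbs]
      field_simp
      ring
    rw [this, mul_eq_zero, sub_eq_zero, sub_eq_zero]
  · have e₁ : (1 / (1 + 2 * s)) * ((1 + (1 + 2 * s)) / (b + (1 + 2 * s))) ^ 2 =
        s ^ 2 / (1 + 2 * s) ^ 3 := by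
      have : b + (1 + 2 * s) = (1 + 2 * s) * (2 * (1 + s) / s) := by
        rw [hbs]
        field_simp
        ring
      rw [this]
      field_simp
      ring
    have e₂ : (1 / (1 + 2 / s)) * ((1 + (1 + 2 / s)) / (b + (1 + 2 / s))) ^ 2 =
        s / (s + 2) ^ 3 := by
      have : b + (1 + 2 / s) = (s + 2) / s * (2 * (1 + s)) := by
        rw [hbs]
        field_simp
        ring
      rw [this]
      field_simp
      ring
    rw [e₁, e₂, div_lt_div_iff₀ (by positivity) (by positivity)]
    have h : 0 < s * ((1 - s) ^ 3 * (1 + s)) :=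
      mul_pos hs (mul_pos (pow_pos (sub_pos.2 hs₁) 3) (by linarith))
    linear_combination h
end

section
/- Let b > 9, let 0 < x₁ < x₂ be the two real roots of t² + (3−b)t + b = 0, and set η_i = (1/x_i)·((1+x_i)/(b+x_i))² for i = 1, 2. If a = η₁ or a = η₂, then the equation a·x = ((1+x)/(b+x))² has exactly two solutions x > 0. -/
theorem sub_one_ne_zero_of_root {b r : ℝ} (h : r ^ 2 + (3 - b) * r + b = 0) : r - 1 ≠ 0 := by
  intro h0
  obtain rfl : r = 1 := by linarith
  linarith

/-- At a positive root `r` of `t² + (3−b)t + b`, the solutions of the equation with parameter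
`(1/r)·((1+r)/(b+r))²` are the double root `r` and the simple root `4r/(r−1)²`. -/
theorem setOf_pos_solutions_eq_pair {b r : ℝ} (hb : 0 < b) (hr : 0 < r)
    (h : r ^ 2 + (3 - b) * r + b = 0) :
    {x : ℝ | 0 < x ∧ (1 / r) * ((1 + r) / (b + r)) ^ 2 * x = ((1 + x) / (b + x)) ^ 2} =
      {r, 4 * r / (r - 1) ^ 2} := by
  have h1 := sub_one_ne_zero_of_root h
  have hbr : b = r * (r + 3) / (r - 1) := by
    rw [eq_div_iff h1]
    linarith
  have hratio : (1 + r) / (b + r) = (r - 1) / (2 * r) := by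
    rw [div_eq_div_iff (by positivity) (by positivity)]
    linarith
  have key : ∀ x : ℝ, 0 < x →
      ((1 / r) * ((1 + r) / (b + r)) ^ 2 * x = ((1 + x) / (b + x)) ^ 2 ↔
        (x - r) ^ 2 * ((r - 1) ^ 2 * x - 4 * r) = 0) := by
    intro x hx
    have hfactor : (r - 1) ^ 2 * x * (b + x) ^ 2 - 4 * r ^ 3 * (1 + x) ^ 2 =
        (x - r) ^ 2 * ((r - 1) ^ 2 * x - 4 * r) := by
      rw [hbr]
      field_simp
      ring
    have hlhs : (1 / r) * ((r - 1) / (2 * r)) ^ 2 * x = (r - 1) ^ 2 * x / (4 * r ^ 3) := by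
      field_simp
      ring
    rw [hratio, hlhs, div_pow, div_eq_div_iff (by positivity) (by positivity), ← hfactor,
      sub_eq_zero, mul_comm ((1 + x) ^ 2)]
  ext x
  simp only [Set.mem_ofPred_eq, Set.mem_insert_iff, Set.mem_singleton_iff]
  have hsimple : (r - 1) ^ 2 * x - 4 * r = 0 ↔ x = 4 * r / (r - 1) ^ 2 := by
    rw [eq_div_iff (pow_ne_zero 2 h1), sub_eq_zero, mul_comm]
  have hiff : (x - r) ^ 2 * ((r - 1) ^ 2 * x - 4 * r) = 0 ↔
      x = r ∨ x = 4 * r / (r - 1) ^ 2 := by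
    rw [mul_eq_zero, hsimple, sq_eq_zero_iff, sub_eq_zero]
  refine ⟨fun ⟨hx, he⟩ => hiff.1 ((key x hx).1 he), fun hx => ?_⟩
  have hpos : 0 < x := by
    rcases hx with rfl | rfl <;> positivity
  exact ⟨hpos, (key x hpos).2 (hiff.2 hx)⟩

theorem encard_pos_solutions_eq_two {b r : ℝ} (hb : 9 < b) (hr : 0 < r)
    (h : r ^ 2 + (3 - b) * r + b = 0) :
    {x : ℝ | 0 < x ∧ (1 / r) * ((1 + r) / (b + r)) ^ 2 * x =
      ((1 + x) / (b + x)) ^ 2}.encard = 2 := by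
  rw [setOf_pos_solutions_eq_pair (by linarith) hr h]
  refine Set.encard_pair fun he => ?_
  have h1 := sub_one_ne_zero_of_root h
  rw [eq_div_iff (pow_ne_zero 2 h1)] at he
  have h3 : r * (r + 1) * (r - 3) = 0 := by linear_combination he
  have hr3 : r - 3 = 0 := (mul_eq_zero.1 h3).resolve_left (by positivity)
  obtain rfl : r = 3 := by linarith
  linarith

/-- for `b > 9`, if `0 < x₁ < x₂` are the two real roots of
`t² + (3−b)t + b = 0` and `ηᵢ = (1/xᵢ)·((1+xᵢ)/(b+xᵢ))²`, then for `a = η₁` or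
`a = η₂` the equation `a·x = ((1+x)/(b+x))²` has exactly two solutions `x > 0`. -/
theorem stmt14 (b x₁ x₂ a : ℝ) (hb : 9 < b)
    (hx₁ : 0 < x₁) (h12 : x₁ < x₂)
    (hr₁ : x₁ ^ 2 + (3 - b) * x₁ + b = 0)
    (hr₂ : x₂ ^ 2 + (3 - b) * x₂ + b = 0)
    (ha : a = (1 / x₁) * ((1 + x₁) / (b + x₁)) ^ 2 ∨
          a = (1 / x₂) * ((1 + x₂) / (b + x₂)) ^ 2) :
    {x : ℝ | 0 < x ∧ a * x = ((1 + x) / (b + x)) ^ 2}.encard = 2 := by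
  rcases ha with rfl | rfl
  · exact encard_pos_solutions_eq_two hb hx₁ hr₁
  · exact encard_pos_solutions_eq_two hb (hx₁.trans h12) hr₂
end

section
/- Let x, y, z > 0 and set b = x(x+z)/(2y²) and a = 2y³/x³. Suppose b > 9 and η₁ < a < η₂, where 0 < x₁ < x₂ are the two real roots of t² + (3−b)t + b = 0 and η_i = (1/x_i)·((1+x_i)/(b+x_i))². Then the equation u = ((x·u + 2y)/(y·u + x + z))² has exactly three solutions u > 0; consequently the system u₁ = ((u₁x + u₂y + z)/(u₁z + u₂y + x))², u₂ = ((u₁y + u₂x + y)/(u₁z + u₂y + x))² has at least three distinct solutions with u₁ = 1 and u₂ > 0. -/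
/-- A cubic vanishing at three distinct points vanishes nowhere else. -/
theorem eq_of_cubic_eq_zero {c₃ c₂ c₁ c₀ r₁ r₂ r₃ t : ℝ} (hc : c₃ ≠ 0)
    (h12 : r₁ ≠ r₂) (h13 : r₁ ≠ r₃) (h23 : r₂ ≠ r₃)
    (h₁ : c₃ * r₁ ^ 3 + c₂ * r₁ ^ 2 + c₁ * r₁ + c₀ = 0)
    (h₂ : c₃ * r₂ ^ 3 + c₂ * r₂ ^ 2 + c₁ * r₂ + c₀ = 0)
    (h₃ : c₃ * r₃ ^ 3 + c₂ * r₃ ^ 2 + c₁ * r₃ + c₀ = 0)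
    (ht : c₃ * t ^ 3 + c₂ * t ^ 2 + c₁ * t + c₀ = 0) :
    t = r₁ ∨ t = r₂ ∨ t = r₃ := by
  have e12 : c₃ * (r₁ ^ 2 + r₁ * r₂ + r₂ ^ 2) + c₂ * (r₁ + r₂) + c₁ = 0 :=
    mul_left_cancel₀ (sub_ne_zero.2 h12) (by linear_combination h₁ - h₂)
  have e13 : c₃ * (r₁ ^ 2 + r₁ * r₃ + r₃ ^ 2) + c₂ * (r₁ + r₃) + c₁ = 0 :=
    mul_left_cancel₀ (sub_ne_zero.2 h13) (by linear_combination h₁ - h₃)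
  have e123 : c₃ * (r₁ + r₂ + r₃) + c₂ = 0 :=
    mul_left_cancel₀ (sub_ne_zero.2 h23) (by linear_combination e12 - e13)
  have hprod : c₃ * ((t - r₁) * ((t - r₂) * (t - r₃))) = 0 := by
    linear_combination ht - h₁ - (t - r₁) * e12 - (t - r₁) * (t - r₂) * e123
  simpa [hc, sub_eq_zero] using hprod

/-- A cubic with alternating signs at `0 < p < q < s` has exactly three positive roots. -/
theorem exists_three_pos_roots_of_cubic {c₃ c₂ c₁ c₀ p q s : ℝ} (hc : c₃ ≠ 0)
    (hp : 0 < p) (hpq : p < q) (hqs : q < s) (h₀ : c₀ < 0)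
    (hPp : 0 < c₃ * p ^ 3 + c₂ * p ^ 2 + c₁ * p + c₀)
    (hPq : c₃ * q ^ 3 + c₂ * q ^ 2 + c₁ * q + c₀ < 0)
    (hPs : 0 < c₃ * s ^ 3 + c₂ * s ^ 2 + c₁ * s + c₀) :
    ∃ r₁ r₂ r₃ : ℝ, r₁ ≠ r₂ ∧ r₁ ≠ r₃ ∧ r₂ ≠ r₃ ∧
      {u : ℝ | 0 < u ∧ c₃ * u ^ 3 + c₂ * u ^ 2 + c₁ * u + c₀ = 0} = {r₁, r₂, r₃} := by
  have hcont (S : Set ℝ) :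
      ContinuousOn (fun u : ℝ => c₃ * u ^ 3 + c₂ * u ^ 2 + c₁ * u + c₀) S := by fun_prop
  obtain ⟨r₁, ⟨h1l, h1r⟩, e₁⟩ := intermediate_value_Ioo hp.le (hcont _)
    (show (0 : ℝ) ∈ Set.Ioo _ _ from ⟨by simpa using h₀, hPp⟩)
  obtain ⟨r₂, ⟨h2l, h2r⟩, e₂⟩ := intermediate_value_Ioo' hpq.le (hcont _)
    (show (0 : ℝ) ∈ Set.Ioo _ _ from ⟨hPq, hPp⟩)
  obtain ⟨r₃, ⟨h3l, h3r⟩, e₃⟩ := intermediate_value_Ioo hqs.le (hcont _)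
    (show (0 : ℝ) ∈ Set.Ioo _ _ from ⟨hPq, hPs⟩)
  have h12 : r₁ ≠ r₂ := (h1r.trans h2l).ne
  have h13 : r₁ ≠ r₃ := ((h1r.trans hpq).trans h3l).ne
  have h23 : r₂ ≠ r₃ := (h2r.trans h3l).ne
  refine ⟨r₁, r₂, r₃, h12, h13, h23, Set.ext fun u => ⟨fun hu => ?_, ?_⟩⟩
  · exact eq_of_cubic_eq_zero hc h12 h13 h23 e₁ e₂ e₃ hu.2
  · rintro (rfl | rfl | rfl)
    · exact ⟨h1l, e₁⟩
    · exact ⟨hp.trans h2l, e₂⟩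
    · exact ⟨(hp.trans hpq).trans h3l, e₃⟩

/-- On the half-line `u > 0` the fixed-point equation is a cubic equation. -/
theorem eq_div_sq_iff_cubic {x y z u : ℝ} (hx : 0 < x) (hy : 0 < y) (hz : 0 < z) (hu : 0 < u) :
    u = ((x * u + 2 * y) / (y * u + x + z)) ^ 2 ↔
      y ^ 2 * u ^ 3 + (2 * y * (x + z) - x ^ 2) * u ^ 2 + ((x + z) ^ 2 - 4 * x * y) * u
        + -(4 * y ^ 2) = 0 := by
  rw [div_pow, eq_div_iff (by positivity)]
  constructor <;> intro h <;> linear_combination h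

/-- The cubic at `u = 2yt/x` in terms of the rescaled variable `t`. -/
theorem cubic_eq_rescaled {x y z t : ℝ} (hx : 0 < x) (hy : 0 < y) (hz : 0 < z) (ht : 0 < t) :
    y ^ 2 * (2 * y * t / x) ^ 3 + (2 * y * (x + z) - x ^ 2) * (2 * y * t / x) ^ 2
        + ((x + z) ^ 2 - 4 * x * y) * (2 * y * t / x) + -(4 * y ^ 2) =
      4 * y ^ 4 / x ^ 2 * (x ^ 2 / y ^ 2 * (t * (x * (x + z) / (2 * y ^ 2) + t) ^ 2)) *
        (2 * y ^ 3 / x ^ 3 -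
          (1 / t) * ((1 + t) / (x * (x + z) / (2 * y ^ 2) + t)) ^ 2) := by
  have hcancel : t * (x * (x + z) / (2 * y ^ 2) + t) ^ 2 *
      ((1 / t) * ((1 + t) / (x * (x + z) / (2 * y ^ 2) + t)) ^ 2) = (1 + t) ^ 2 := by
    field_simp
  rw [mul_sub, mul_assoc (4 * y ^ 4 / x ^ 2) _ ((1 / t) * _), mul_assoc (x ^ 2 / y ^ 2), hcancel]
  field_simp
  ring

/-- with `x, y, z > 0`, `b = x(x+z)/(2y²)`, `a = 2y³/x³`, if `b > 9`
and `η₁ < a < η₂` (where `0 < x₁ < x₂` are the roots of `t² + (3−b)t + b = 0` and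
`ηᵢ = (1/xᵢ)·((1+xᵢ)/(b+xᵢ))²`), then `u = ((xu+2y)/(yu+x+z))²` has exactly three
positive solutions; consequently the translation-invariant system has at least three
distinct solutions with `u₁ = 1` and `u₂ > 0`. -/
theorem stmt15 (x y z x₁ x₂ : ℝ) (hx : 0 < x) (hy : 0 < y) (hz : 0 < z)
    (hx₁ : 0 < x₁) (h12 : x₁ < x₂)
    (hr₁ : x₁ ^ 2 + (3 - x * (x + z) / (2 * y ^ 2)) * x₁ + x * (x + z) / (2 * y ^ 2) = 0)
    (hr₂ : x₂ ^ 2 + (3 - x * (x + z) / (2 * y ^ 2)) * x₂ + x * (x + z) / (2 * y ^ 2) = 0)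
    (hb : 9 < x * (x + z) / (2 * y ^ 2))
    (ha₁ : (1 / x₁) * ((1 + x₁) / (x * (x + z) / (2 * y ^ 2) + x₁)) ^ 2 < 2 * y ^ 3 / x ^ 3)
    (ha₂ : 2 * y ^ 3 / x ^ 3 < (1 / x₂) * ((1 + x₂) / (x * (x + z) / (2 * y ^ 2) + x₂)) ^ 2) :
    {u : ℝ | 0 < u ∧ u = ((x * u + 2 * y) / (y * u + x + z)) ^ 2}.encard = 3 ∧
    ∃ v₁ v₂ v₃ : ℝ, v₁ ≠ v₂ ∧ v₁ ≠ v₃ ∧ v₂ ≠ v₃ ∧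
      ∀ v ∈ ({v₁, v₂, v₃} : Set ℝ), 0 < v ∧
        (1 : ℝ) = ((1 * x + v * y + z) / (1 * z + v * y + x)) ^ 2 ∧
        v = ((1 * y + v * x + y) / (1 * z + v * y + x)) ^ 2 := by
  have hb' : 2 * y ^ 2 < x * (x + z) := by
    rw [lt_div_iff₀ (by positivity)] at hb
    nlinarith [sq_nonneg y]
  have hx₂ : 0 < x₂ := hx₁.trans h12
  obtain ⟨r₁, r₂, r₃, h12', h13, h23, hS⟩ := exists_three_pos_roots_of_cubic
    (c₃ := y ^ 2) (c₂ := 2 * y * (x + z) - x ^ 2) (c₁ := (x + z) ^ 2 - 4 * x * y)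
    (c₀ := -(4 * y ^ 2)) (p := 2 * y * x₁ / x) (q := 2 * y * x₂ / x)
    (s := 2 * y * x₂ / x + (x / y) ^ 2) (by positivity) (by positivity)
    (by gcongr) (lt_add_of_pos_right _ (by positivity)) (by simp; positivity)
    (by
      rw [cubic_eq_rescaled hx hy hz hx₁]
      exact mul_pos (by positivity) (sub_pos.2 ha₁))
    (by
      rw [cubic_eq_rescaled hx hy hz hx₂]
      exact mul_neg_of_pos_of_neg (by positivity) (sub_neg.2 ha₂))
    (by
      set q := 2 * y * x₂ / x
      have hq : 0 < q := by positivity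
      set k := x / y with hk
      have hk0 : 0 < k := by positivity
      have hxk : x = k * y := by rw [hk]; field_simp
      have hkz : 2 * y < k * (x + z) := by
        refine lt_of_mul_lt_mul_right ?_ hy.le
        calc 2 * y * y = 2 * y ^ 2 := by ring
          _ < x * (x + z) := hb'
          _ = k * (x + z) * y := by rw [hxk]; ring
      have hlt : (x * (q + k ^ 2) + 2 * y) ^ 2 < (k * (y * (q + k ^ 2) + (x + z))) ^ 2 := by
        refine pow_lt_pow_left₀ ?_ (by positivity) two_ne_zero
        have : x * (q + k ^ 2) = k * y * (q + k ^ 2) := by rw [← hxk]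
        linarith
      have hpos : 0 < q * (y * (q + k ^ 2) + (x + z)) ^ 2 := by positivity
      linarith)
  have hset : {u : ℝ | 0 < u ∧ u = ((x * u + 2 * y) / (y * u + x + z)) ^ 2} = {r₁, r₂, r₃} := by
    rw [← hS]
    ext u
    exact and_congr_right fun hu => eq_div_sq_iff_cubic hx hy hz hu
  refine ⟨?_, r₁, r₂, r₃, h12', h13, h23, fun v hv => ?_⟩
  · rw [hset]
    exact Set.encard_eq_three.2 ⟨r₁, r₂, r₃, h12', h13, h23, rfl⟩
  · rw [← hset] at hv
    obtain ⟨hv0, hv⟩ := hv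
    refine ⟨hv0, ?_, ?_⟩
    · rw [show 1 * x + v * y + z = 1 * z + v * y + x by ring,
        div_self (by positivity), one_pow]
    · rw [show 1 * y + v * x + y = x * v + 2 * y by ring,
        show 1 * z + v * y + x = y * v + x + z by ring]
      exact hv
end

section
/- Let x, y, z > 0 satisfy x(x+z) = 20y² and 1/32 < 2y³/x³ < 4/125. Then the equation u = ((x·u + 2y)/(y·u + x + z))² has exactly three solutions u > 0. -/
/-- A nonzero cubic with three distinct roots has no other root. -/
lemma cubic_root_eq_of_three_roots_s16 {k l m n a b c t : ℝ} (hk : k ≠ 0) (hab : a ≠ b)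
    (hac : a ≠ c) (hbc : b ≠ c)
    (ha : k * a ^ 3 + l * a ^ 2 + m * a + n = 0) (hb : k * b ^ 3 + l * b ^ 2 + m * b + n = 0)
    (hc : k * c ^ 3 + l * c ^ 2 + m * c + n = 0) (ht : k * t ^ 3 + l * t ^ 2 + m * t + n = 0) :
    t = a ∨ t = b ∨ t = c := by
  by_contra! h
  obtain ⟨hta, htb, htc⟩ := h
  have sum_eq : ∀ s : ℝ, s ≠ a → s ≠ b → k * s ^ 3 + l * s ^ 2 + m * s + n = 0 →
      k * (a + b + s) + l = 0 := by
    intro s hsa hsb hs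
    have hb' : k * (a ^ 2 + a * b + b ^ 2) + l * (a + b) + m = 0 :=
      mul_left_cancel₀ (sub_ne_zero.2 hab) (by linear_combination ha - hb)
    have hs' : k * (a ^ 2 + a * s + s ^ 2) + l * (a + s) + m = 0 :=
      mul_left_cancel₀ (sub_ne_zero.2 hsa) (by linear_combination hs - ha)
    exact mul_left_cancel₀ (sub_ne_zero.2 hsb) (by linear_combination hs' - hb')
  exact htc (mul_left_cancel₀ hk
    (by linear_combination sum_eq t hta htb ht - sum_eq c hac.symm hbc.symm hc))

/-- The rescaled fixed-point cubic has exactly three positive roots. -/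
lemma exists_three_positive_roots {η : ℝ} (h₁ : 1 / 32 < η) (h₂ : η < 4 / 125) :
    ∃ a b c : ℝ, 0 < a ∧ a < b ∧ b < c ∧
      ∀ t : ℝ, η * t * (t + 10) ^ 2 - (1 + t) ^ 2 = 0 ↔ t = a ∨ t = b ∨ t = c := by
  have hcont : Continuous fun t : ℝ => η * t * (t + 10) ^ 2 - (1 + t) ^ 2 := by fun_prop
  obtain ⟨a, ⟨ha₀, ha₂⟩, ha⟩ :=
    intermediate_value_Ioo (by norm_num : (0 : ℝ) ≤ 2) hcont.continuousOn
      (show (0 : ℝ) ∈ Set.Ioo _ _ by constructor <;> norm_num <;> linarith)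
  obtain ⟨b, ⟨hb₂, hb₅⟩, hb⟩ :=
    intermediate_value_Ioo' (by norm_num : (2 : ℝ) ≤ 5) hcont.continuousOn
      (show (0 : ℝ) ∈ Set.Ioo _ _ by constructor <;> norm_num <;> linarith)
  obtain ⟨c, ⟨hc₅, -⟩, hc⟩ :=
    intermediate_value_Ioo (by norm_num : (5 : ℝ) ≤ 100) hcont.continuousOn
      (show (0 : ℝ) ∈ Set.Ioo _ _ by constructor <;> norm_num <;> linarith)
  have hab : a < b := ha₂.trans hb₂
  have hbc : b < c := hb₅.trans hc₅
  refine ⟨a, b, c, ha₀, hab, hbc, fun t => ⟨fun ht => ?_, ?_⟩⟩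
  · refine cubic_root_eq_of_three_roots_s16 (k := η) (l := 20 * η - 1) (m := 100 * η - 2) (n := -1)
      (by linarith) hab.ne (hab.trans hbc).ne hbc.ne ?_ ?_ ?_ ?_
    · linear_combination ha
    · linear_combination hb
    · linear_combination hc
    · linear_combination ht
  · rintro (rfl | rfl | rfl)
    exacts [ha, hb, hc]

/-- if `x, y, z > 0` satisfy `x(x+z) = 20y²` and
`1/32 < 2y³/x³ < 4/125`, then the equation `u = ((xu+2y)/(yu+x+z))²` has exactly
three solutions `u > 0`. -/
theorem stmt16 (x y z : ℝ) (hx : 0 < x) (hy : 0 < y) (hz : 0 < z)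
    (hxz : x * (x + z) = 20 * y ^ 2)
    (h₁ : 1 / 32 < 2 * y ^ 3 / x ^ 3) (h₂ : 2 * y ^ 3 / x ^ 3 < 4 / 125) :
    {u : ℝ | 0 < u ∧ u = ((x * u + 2 * y) / (y * u + x + z)) ^ 2}.encard = 3 := by
  obtain ⟨a, b, c, ha, hab, hbc, hroots⟩ := exists_three_positive_roots h₁ h₂
  have hs : 0 < 2 * y / x := by positivity
  have key : ∀ t : ℝ, 0 < t →
      (2 * y / x * t = ((x * (2 * y / x * t) + 2 * y) / (y * (2 * y / x * t) + x + z)) ^ 2 ↔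
        t = a ∨ t = b ∨ t = c) := by
    intro t ht
    have hnum : x * (2 * y / x * t) + 2 * y = 2 * y * (1 + t) := by field_simp; ring
    have hden : y * (2 * y / x * t) + x + z = 2 * y ^ 2 / x * (t + 10) := by
      field_simp
      linear_combination hxz
    have hquot : 2 * y * (1 + t) / (2 * y ^ 2 / x * (t + 10)) =
        x / y * ((1 + t) / (t + 10)) := by
      field_simp
    have hη : 2 * y / x * t - (x / y * ((1 + t) / (t + 10))) ^ 2 =
        (x / y) ^ 2 / (t + 10) ^ 2 *
          (2 * y ^ 3 / x ^ 3 * t * (t + 10) ^ 2 - (1 + t) ^ 2) := by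
      field_simp
    have hne : (x / y) ^ 2 / (t + 10) ^ 2 ≠ 0 := by positivity
    rw [hnum, hden, hquot, ← hroots, ← sub_eq_zero, hη, mul_eq_zero, or_iff_right hne]
  have himage : {u : ℝ | 0 < u ∧ u = ((x * u + 2 * y) / (y * u + x + z)) ^ 2} =
      (fun t => 2 * y / x * t) '' {a, b, c} := by
    ext u
    simp only [Set.mem_ofPred_eq, Set.mem_image, Set.mem_insert_iff, Set.mem_singleton_iff]
    constructor
    · rintro ⟨hu, h⟩
      have hut : 2 * y / x * (u / (2 * y / x)) = u := mul_div_cancel₀ u hs.ne'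
      exact ⟨u / (2 * y / x), (key _ (div_pos hu hs)).1 (by rwa [hut]), hut⟩
    · rintro ⟨t, ht, rfl⟩
      have ht₀ : 0 < t := by rcases ht with rfl | rfl | rfl <;> linarith
      exact ⟨mul_pos hs ht₀, (key t ht₀).2 ht⟩
  rw [himage, (mul_right_injective₀ hs.ne').encard_image, Set.encard_eq_three]
  exact ⟨a, b, c, hab.ne, (hab.trans hbc).ne, hbc.ne, rfl⟩
end

section
/- Let x > 0 and define f(t) = ((x·t + 2)/(t + 2x + 1))² for t > 0. Then every u > 0 satisfying f(f(u)) = u also satisfies f(u) = u. -/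
/-- The map `f(t) = ((x·t + 2)/(t + 2x + 1))²` (the case `y = 1`, `z = x + 1`). -/
noncomputable def f17 (x t : ℝ) : ℝ := ((x * t + 2) / (t + 2 * x + 1)) ^ 2

/-- A positive solution of the system satisfied by the square roots of a 2-periodic orbit
is diagonal. -/
theorem eq_of_two_cycle {x a b : ℝ} (hx : 0 < x) (ha : 0 < a) (hb : 0 < b)
    (h₁ : a * (b ^ 2 + 2 * x + 1) = x * b ^ 2 + 2)
    (h₂ : b * (a ^ 2 + 2 * x + 1) = x * a ^ 2 + 2) : a = b := by
  by_contra hab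
  have hprod : a * b = 2 * x + 1 + x * (a + b) := by
    refine mul_left_cancel₀ (sub_ne_zero.2 hab) ?_
    linear_combination h₂ - h₁
  have hsum : (x + 1) ^ 2 * (a + b) = 2 - 2 * x ^ 2 - x := by
    linear_combination (1 / 2) * h₁ + (1 / 2) * h₂ - (1 / 2) * (a + b + 2 * x) * hprod
  have hlt : a + b < 2 := by
    by_contra! h
    nlinarith [mul_le_mul_of_nonneg_left h (sq_nonneg (x + 1)), sq_nonneg x]
  nlinarith [sq_nonneg (a - b), mul_pos hx (add_pos ha hb)]

/-- for `x > 0`, every `u > 0` with `f(f(u)) = u` satisfies `f(u) = u`. -/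
theorem stmt17 (x : ℝ) (hx : 0 < x) :
    ∀ u : ℝ, 0 < u → f17 x (f17 x u) = u → f17 x u = u := by
  intro u hu h
  set b := (x * u + 2) / (u + 2 * x + 1) with hb
  have hfu : f17 x u = b ^ 2 := rfl
  set a := (x * b ^ 2 + 2) / (b ^ 2 + 2 * x + 1) with ha
  have hau : a ^ 2 = u := by rw [← h, hfu]; rfl
  have hb0 : 0 < b := by positivity
  have ha0 : 0 < a := by positivity
  have hab : a = b := by
    refine eq_of_two_cycle hx ha0 hb0 ?_ ?_
    · exact div_mul_cancel₀ _ (by positivity)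
    · rw [hau]
      exact div_mul_cancel₀ _ (by positivity)
  rw [hfu, ← hab, hau]
end

section
/- There is a unique θ > 0 with 3θ⁴ + 10θ³ + 6θ² − 1 = 0 (numerically θ ≈ 0.32359). For every x with 0 < x < θ, defining f(t) = ((x·t + 2)/(t + 2x))² for t > 0, there exists u > 0 such that f(f(u)) = u and f(u) ≠ u. -/
/-- The map `f(t) = ((x·t + 2)/(t + 2x))²` (the case `y = 1`, `z = x`). -/
noncomputable def f18 (x t : ℝ) : ℝ := ((x * t + 2) / (t + 2 * x)) ^ 2

/-- `f18 x` maps `a ^ 2` to `b ^ 2` as soon as `ab = x(a + b + 2)` and `x(2 + x)(a + b) = 2(1 - x²)`,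
two conditions that are symmetric in `a` and `b`. -/
lemma f18_sq_eq_sq {x a b : ℝ} (hx : 0 < x) (hp : a * b = x * (a + b + 2))
    (hs : x * (2 + x) * (a + b) = 2 * (1 - x ^ 2)) : f18 x (a ^ 2) = b ^ 2 := by
  have hden : a ^ 2 + 2 * x ≠ 0 := by positivity
  have h : (x * a ^ 2 + 2) / (a ^ 2 + 2 * x) = b := by
    rw [div_eq_iff hden]
    linear_combination -(a + x) * hp - hs
  rw [f18, h]

lemma quartic_lt_quartic {a b : ℝ} (ha : 0 < a) (hab : a < b) :
    3 * a ^ 4 + 10 * a ^ 3 + 6 * a ^ 2 - 1 < 3 * b ^ 4 + 10 * b ^ 3 + 6 * b ^ 2 - 1 := by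
  gcongr

lemma exists_two_cycle {x : ℝ} (hx : 0 < x) (hD : 3 * x ^ 4 + 10 * x ^ 3 + 6 * x ^ 2 - 1 < 0) :
    ∃ u : ℝ, 0 < u ∧ f18 x (f18 x u) = u ∧ f18 x u ≠ u := by
  have hx1 : x ^ 2 < 1 := by nlinarith [pow_pos hx 2, pow_pos hx 3, pow_pos hx 4]
  obtain ⟨s, hs⟩ : ∃ s, x * (2 + x) * s = 2 * (1 - x ^ 2) :=
    ⟨2 * (1 - x ^ 2) / (x * (2 + x)), by field_simp⟩
  have hk : 0 < x * (2 + x) := by positivity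
  have hs0 : 0 < s := by
    refine pos_of_mul_pos_right (?_ : 0 < x * (2 + x) * s) hk.le
    linarith
  have hdisc : 0 < s ^ 2 - 4 * (x * (s + 2)) := by
    refine pos_of_mul_pos_right (?_ : 0 < (x * (2 + x)) ^ 2 * _) (by positivity)
    have : (x * (2 + x)) ^ 2 * (s ^ 2 - 4 * (x * (s + 2))) =
        -4 * (3 * x ^ 4 + 10 * x ^ 3 + 6 * x ^ 2 - 1) := by
      linear_combination (x * (2 + x) * s + 2 * (1 - x ^ 2) - 4 * x * (x * (2 + x))) * hs
    linarith
  set r := √(s ^ 2 - 4 * (x * (s + 2))) with hr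
  have hr0 : 0 < r := Real.sqrt_pos.2 hdisc
  have hrsq : r ^ 2 = s ^ 2 - 4 * (x * (s + 2)) := Real.sq_sqrt hdisc.le
  have hab : f18 x (((s + r) / 2) ^ 2) = ((s - r) / 2) ^ 2 :=
    f18_sq_eq_sq hx (by linear_combination -hrsq / 4) (by linear_combination hs)
  have hba : f18 x (((s - r) / 2) ^ 2) = ((s + r) / 2) ^ 2 :=
    f18_sq_eq_sq hx (by linear_combination -hrsq / 4) (by linear_combination hs)
  refine ⟨((s + r) / 2) ^ 2, by positivity, by rw [hab, hba], ?_⟩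
  rw [hab]
  have := mul_pos hs0 hr0
  exact ne_of_lt (by linarith)

/-- there is a unique `θ > 0` with `3θ⁴ + 10θ³ + 6θ² − 1 = 0`, and
for every `x` with `0 < x < θ` there exists `u > 0` with `f(f(u)) = u` and
`f(u) ≠ u`. -/
theorem stmt18 :
    (∃! θ : ℝ, 0 < θ ∧ 3 * θ ^ 4 + 10 * θ ^ 3 + 6 * θ ^ 2 - 1 = 0) ∧
    ∀ θ : ℝ, 0 < θ → 3 * θ ^ 4 + 10 * θ ^ 3 + 6 * θ ^ 2 - 1 = 0 →
      ∀ x : ℝ, 0 < x → x < θ →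
        ∃ u : ℝ, 0 < u ∧ f18 x (f18 x u) = u ∧ f18 x u ≠ u := by
  refine ⟨?_, fun θ _ hroot x hx hlt =>
    exists_two_cycle hx ((quartic_lt_quartic hx hlt).trans_eq hroot)⟩
  obtain ⟨θ, ⟨hθ, -⟩, hroot⟩ :
      (0 : ℝ) ∈ (fun t : ℝ => 3 * t ^ 4 + 10 * t ^ 3 + 6 * t ^ 2 - 1) '' Set.Ioo 0 1 :=
    intermediate_value_Ioo zero_le_one (by fun_prop) (by norm_num)
  refine ⟨θ, ⟨hθ, hroot⟩, fun τ ⟨hτ, hτroot⟩ => ?_⟩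
  rcases lt_trichotomy τ θ with h | h | h
  · exact absurd (hτroot.trans hroot.symm) (quartic_lt_quartic hτ h).ne
  · exact h
  · exact absurd (hroot.trans hτroot.symm) (quartic_lt_quartic hθ h).ne
end

section
/- Let x > 0 and z > 0, and define f(t) = ((x·t + 2x)/(x·t + x + z))² for t > 0. Then every u > 0 satisfying f(f(u)) = u also satisfies f(u) = u. -/
/-- The map `f(t) = ((x·t + 2x)/(x·t + x + z))²` (the case `y = x`, `z` arbitrary). -/
noncomputable def f19 (x z t : ℝ) : ℝ := ((x * t + 2 * x) / (x * t + x + z)) ^ 2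

/-- A pair of positive square roots exchanged by the period-two relations is constant. -/
theorem eq_of_two_cycle_sqrt {x z p q : ℝ} (hx : 0 < x) (hz : 0 < z) (hp : 0 < p) (hq : 0 < q)
    (hqp : q * (x * p ^ 2 + x + z) = x * p ^ 2 + 2 * x)
    (hpq : p * (x * q ^ 2 + x + z) = x * q ^ 2 + 2 * x) : p = q := by
  by_contra hne
  have hprod : x * (p * q) = x + z + x * (p + q) := by
    apply mul_left_cancel₀ (sub_ne_zero.mpr hne)
    linear_combination hqp - hpq
  have hsum : (2 * x + z) * (p + q) = x - z := by
    linear_combination (1 / 2) * hqp + (1 / 2) * hpq - (1 / 2) * (p + q + 2) * hprod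
  have hs : p + q < 1 / 2 := by
    by_contra! h
    nlinarith [mul_le_mul_of_nonneg_left h (by positivity : 0 ≤ 2 * x + z)]
  have hlt : p * q < 1 := by nlinarith
  nlinarith [mul_pos hx (add_pos hp hq), mul_lt_mul_of_pos_left hlt hx]

/-- for `x, z > 0`, every `u > 0` with `f(f(u)) = u` satisfies
`f(u) = u`. -/
theorem stmt19 (x z : ℝ) (hx : 0 < x) (hz : 0 < z) :
    ∀ u : ℝ, 0 < u → f19 x z (f19 x z u) = u → f19 x z u = u := by
  intro u hu h
  obtain ⟨q, hq⟩ : ∃ q, q = (x * u + 2 * x) / (x * u + x + z) := ⟨_, rfl⟩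
  have hfu : f19 x z u = q ^ 2 := by rw [f19, hq]
  obtain ⟨p, hp⟩ : ∃ p, p = (x * q ^ 2 + 2 * x) / (x * q ^ 2 + x + z) := ⟨_, rfl⟩
  have hup : p ^ 2 = u := by rw [← h, hfu, f19, hp]
  have hp0 : 0 < p := by rw [hp]; positivity
  have hq0 : 0 < q := by rw [hq]; positivity
  rw [eq_div_iff (by positivity)] at hp hq
  rw [← hup] at hq
  rw [hfu, ← hup, eq_of_two_cycle_sqrt hx hz hp0 hq0 hq hp]
end
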